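/- For every positive integer n, the determinant of the n×n matrix whose (i,j)-entry (0 ≤ i,j ≤ n−1) is 4^{j+1}·binom(2i+j+1, 2i+1) + binom(2i−j−1, 2i+1) equals 3^{n(n+1)/2} times the product over i = 1 to n of Γ(3i−1)·Γ((i+1)/2) / (Γ(2i)·Γ((3i−1)/2)). -/

import Mathlib

open scoped BigOperators

/-- Generalized binomial coefficient: `binom α p = α(α−1)⋯(α−p+1)/p!`. -/
noncomputable def binom (α : ℤ) (p : ℕ) : ℝ :=
  (∏ k ∈ Finset.range p, ((α : ℝ) - (k : ℝ))) / (p.factorial : ℝ)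

theorem prod_range_natCast_sub (m p : ℕ) :
    ∏ k ∈ Finset.range p, ((m : ℝ) - k) = m.descFactorial p := by
  induction p with
  | zero => simp
  | succ p ih =>
    rw [Finset.prod_range_succ, ih, Nat.descFactorial_succ]
    rcases le_or_gt p m with h | h
    · push_cast [Nat.cast_sub h]; ring
    · simp [Nat.descFactorial_eq_zero_iff_lt.mpr h]

theorem binom_natCast (m p : ℕ) : binom (m : ℤ) p = m.choose p := by
  rw [binom, Int.cast_natCast, prod_range_natCast_sub, Nat.descFactorial_eq_factorial_mul_choose]
  push_cast
  field_simp

theorem binom_reflect (m i : ℕ) :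
    binom (2 * (i : ℤ) - m) (2 * i + 1) = -(m.choose (2 * i + 1) : ℝ) := by
  rw [← binom_natCast, binom, binom, ← Finset.prod_range_reflect, ← neg_div]
  congr 1
  have h : ∀ k ∈ Finset.range (2 * i + 1),
      ((2 * (i : ℤ) - m : ℤ) : ℝ) - ((2 * i + 1 - 1 - k : ℕ) : ℝ) = -(((m : ℤ) : ℝ) - k) := by
    intro k hk
    have : k ≤ 2 * i := by simpa [Nat.lt_succ_iff] using hk
    rw [Nat.add_sub_cancel]
    push_cast [Nat.cast_sub this]
    ring
  rw [Finset.prod_congr rfl h, Finset.prod_neg]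
  simp [pow_succ, pow_mul]

open Polynomial in
/-- Unitriangular change of basis among polynomials without constant term. -/
theorem det_functional_eq_det_X_pow {n : ℕ} (L : Fin n → ℝ[X] →ₗ[ℝ] ℝ) (hL : ∀ i, L i 1 = 0)
    (p : Fin n → ℝ[X]) (hp : ∀ j, (p j).Monic) (hd : ∀ j, (p j).natDegree = j + 1) :
    (Matrix.of fun i j => L i (p j)).det =
      (Matrix.of fun i j : Fin n => L i (X ^ ((j : ℕ) + 1))).det := by
  have hc : (Matrix.of fun i j : Fin n => ((p j).divX).coeff i).det = 1 := by
    apply Matrix.det_matrixOfPolynomials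
    · intro j
      rw [natDegree_divX_eq_natDegree_tsub_one, hd, Nat.add_sub_cancel]
    · intro j
      rw [Monic, leadingCoeff, natDegree_divX_eq_natDegree_tsub_one, coeff_divX, hd,
        Nat.add_sub_cancel, ← hd]
      exact hp j
  rw [← mul_one (Matrix.det (Matrix.of fun i j : Fin n => L i (X ^ ((j : ℕ) + 1)))), ← hc,
    ← Matrix.det_mul]
  congr 1
  ext i j
  rw [Matrix.mul_apply]
  simp only [Matrix.of_apply, coeff_divX]
  conv_lhs => rw [(p j).as_sum_range_C_mul_X_pow' (n := n + 1) (by rw [hd]; omega)]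
  rw [map_sum, Finset.sum_range_succ', ← Fin.sum_univ_eq_sum_range
    (fun k => L i (C ((p j).coeff (k + 1)) * X ^ (k + 1)))]
  simp only [← smul_eq_C_mul, map_smul, pow_zero, hL, smul_eq_mul, mul_zero, add_zero]
  exact Finset.sum_congr rfl fun _ _ => mul_comm _ _

/-- The ratio of consecutive determinants. -/
noncomputable def detRatio (n : ℕ) : ℝ :=
  3 ^ n * (Real.Gamma (3 * (n : ℝ) - 1) * Real.Gamma (((n : ℝ) + 1) / 2)
            / (Real.Gamma (2 * (n : ℝ)) * Real.Gamma ((3 * (n : ℝ) - 1) / 2)))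

theorem detRatio_one : detRatio 1 = 3 := by
  norm_num [detRatio]

theorem detRatio_two : detRatio 2 = 24 := by
  have h1 : Real.Gamma 5 = 24 := by
    rw [show (5 : ℝ) = (4 : ℕ) + 1 by norm_num, Real.Gamma_nat_eq_factorial]
    norm_num [Nat.factorial]
  have h2 : Real.Gamma 4 = 6 := by
    rw [show (4 : ℝ) = (3 : ℕ) + 1 by norm_num, Real.Gamma_nat_eq_factorial]
    norm_num [Nat.factorial]
  have h3 : Real.Gamma (5 / 2) = 3 / 2 * Real.Gamma (3 / 2) := by
    rw [← Real.Gamma_add_one (by norm_num)]; norm_num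
  have h4 : Real.Gamma (3 / 2) ≠ 0 := (Real.Gamma_pos_of_pos (by norm_num)).ne'
  norm_num [detRatio, h1, h2, h3]
  field_simp
  norm_num

theorem detRatio_pos {n : ℕ} (hn : 0 < n) : 0 < detRatio n := by
  have : (1 : ℝ) ≤ n := by exact_mod_cast hn
  have h1 := Real.Gamma_pos_of_pos (s := 3 * (n : ℝ) - 1) (by linarith)
  have h2 := Real.Gamma_pos_of_pos (s := ((n : ℝ) + 1) / 2) (by linarith)
  have h3 := Real.Gamma_pos_of_pos (s := 2 * (n : ℝ)) (by linarith)
  have h4 := Real.Gamma_pos_of_pos (s := (3 * (n : ℝ) - 1) / 2) (by linarith)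
  rw [detRatio]
  positivity

theorem detRatio_add_two {n : ℕ} (hn : 0 < n) :
    (2 * n + 1) * (2 * n + 3) * detRatio (n + 2) = 27 * (3 * n + 2) * (3 * n + 4) * detRatio n := by
  have hn1 : (1 : ℝ) ≤ n := by exact_mod_cast hn
  have h3 := Real.Gamma_pos_of_pos (s := 2 * (n : ℝ)) (by linarith)
  have h4 := Real.Gamma_pos_of_pos (s := (3 * (n : ℝ) - 1) / 2) (by linarith)
  have e1 : Real.Gamma (3 * ((n + 2 : ℕ) : ℝ) - 1) = (3 * n + 4) * (3 * n + 3) * (3 * n + 2) *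
      (3 * n + 1) * (3 * n) * (3 * n - 1) * Real.Gamma (3 * (n : ℝ) - 1) := by
    have : 3 * ((n + 2 : ℕ) : ℝ) - 1 = 3 * (n : ℝ) - 1 + 1 + 1 + 1 + 1 + 1 + 1 := by
      push_cast; ring
    rw [this]
    repeat rw [Real.Gamma_add_one (by linarith)]
    ring
  have e2 : Real.Gamma ((((n + 2 : ℕ) : ℝ) + 1) / 2) =
      ((n : ℝ) + 1) / 2 * Real.Gamma (((n : ℝ) + 1) / 2) := by
    rw [← Real.Gamma_add_one (by linarith)]
    congr 1; push_cast; ring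
  have e3 : Real.Gamma (2 * ((n + 2 : ℕ) : ℝ)) = (2 * n + 3) * (2 * n + 2) * (2 * n + 1) *
      (2 * n) * Real.Gamma (2 * (n : ℝ)) := by
    have : 2 * ((n + 2 : ℕ) : ℝ) = 2 * (n : ℝ) + 1 + 1 + 1 + 1 := by
      push_cast; ring
    rw [this]
    repeat rw [Real.Gamma_add_one (by linarith)]
    ring
  have e4 : Real.Gamma ((3 * ((n + 2 : ℕ) : ℝ) - 1) / 2) = (3 * n + 3) / 2 * ((3 * n + 1) / 2) *
      ((3 * n - 1) / 2) * Real.Gamma ((3 * (n : ℝ) - 1) / 2) := by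
    have : (3 * ((n + 2 : ℕ) : ℝ) - 1) / 2 = (3 * (n : ℝ) - 1) / 2 + 1 + 1 + 1 := by
      push_cast; ring
    rw [this]
    repeat rw [Real.Gamma_add_one (by linarith)]
    ring
  rw [detRatio, detRatio, e1, e2, e3, e4]
  generalize Real.Gamma (3 * (n : ℝ) - 1) = a at *
  generalize Real.Gamma (((n : ℝ) + 1) / 2) = b at *
  generalize Real.Gamma (2 * (n : ℝ)) = c at *
  generalize Real.Gamma ((3 * (n : ℝ) - 1) / 2) = d at *
  obtain ⟨m, hm⟩ : ∃ m, m = 3 * (n : ℝ) - 1 := ⟨_, rfl⟩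
  have h5 : m ≠ 0 := by linarith
  rw [← hm]
  field_simp
  ring

theorem prod_detRatio (n : ℕ) :
    3 ^ (n * (n + 1) / 2) * ∏ i ∈ Finset.Icc 1 n,
          Real.Gamma (3 * (i : ℝ) - 1) * Real.Gamma (((i : ℝ) + 1) / 2)
            / (Real.Gamma (2 * (i : ℝ)) * Real.Gamma ((3 * (i : ℝ) - 1) / 2)) =
      ∏ j : Fin n, detRatio (j + 1) := by
  induction n with
  | zero => simp
  | succ n ih =>
    have h : (n + 1) * (n + 1 + 1) / 2 = n * (n + 1) / 2 + (n + 1) := by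
      rw [← Nat.add_mul_div_right _ _ two_pos]
      ring_nf
    rw [Finset.prod_Icc_succ_top (by omega), Fin.prod_univ_castSucc]
    simp only [Fin.val_castSucc, Fin.val_last]
    rw [← ih, h, pow_add, detRatio]
    ring

namespace TwistedPair
open PowerSeries

/-- `1 / (1 - X)`. -/
noncomputable def geom : ℝ⟦X⟧ := mk 1

/-- `1 / (1 + X)`. -/
noncomputable def geomAlt : ℝ⟦X⟧ := rescale (-1) geom

theorem geom_mul : geom * (1 - X) = 1 := mk_one_mul_one_sub_eq_one ℝ

theorem geomAlt_mul : geomAlt * (1 + X) = 1 := by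
  have := congrArg (rescale (-1 : ℝ)) geom_mul
  simpa [geomAlt, rescale_X] using this

/-- `1 / (1 - X²)`. -/
noncomputable def geomSq : ℝ⟦X⟧ := geom * geomAlt

theorem geomSq_mul : geomSq * (1 - X ^ 2) = 1 := by
  rw [geomSq]
  linear_combination geomAlt * (1 + X) * geom_mul + geomAlt_mul

theorem derivative_geomSq : d⁄dX ℝ geomSq = 2 * X * geomSq ^ 2 := by
  have h := congrArg (d⁄dX ℝ) geomSq_mul
  simp [Derivation.leibniz] at h
  linear_combination geomSq * h - (d⁄dX ℝ geomSq) * geomSq_mul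

/-- The rational function `X² (9 - X²)² / (1 - X²)²`, invariant under an action of `S₃`. -/
noncomputable def invariant : ℝ⟦X⟧ := (9 * X - X ^ 3) ^ 2 * geomSq ^ 2

theorem derivative_invariant :
    (9 - 6 * X ^ 2 - 3 * X ^ 4) * d⁄dX ℝ invariant =
      6 * (9 * X - X ^ 3) * (27 + invariant) := by
  have h := geomSq_mul
  have h9 : d⁄dX ℝ (9 : ℝ⟦X⟧) = 0 := (d⁄dX ℝ).map_natCast 9
  simp [invariant, Derivation.leibniz, Derivation.leibniz_pow, derivative_geomSq, h9]
  generalize geomSq = V at *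
  generalize (X : ℝ⟦X⟧) = x at *
  grind

/-- Odd power series obtained from `twist ^ m - twist (-X) ^ m` by three-term elimination;
`antisym k` has leading term `X ^ (2 * k + 1)`. -/
noncomputable def antisym : ℕ → ℝ⟦X⟧
  | 0 => C (1 / 3) * (3 * X + X ^ 3) * geomSq
  | 1 => C (1 / 3) * (3 * X + X ^ 3) * geomSq * (X ^ 2 * geomSq)
  | k + 2 => C ((2 * (k : ℝ) + 3) * (2 * k + 5) / (27 * (3 * k + 5) * (3 * k + 7))) *
      (invariant * antisym k - 81 * antisym (k + 1))

theorem natCast_factor (k : ℕ) : 27 * (3 * (k : ℝ⟦X⟧) + 5) * (3 * (k : ℝ⟦X⟧) + 7) =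
    C (27 * (3 * (k : ℝ) + 5) * (3 * k + 7)) := by
  simp [map_ofNat]

theorem antisym_add_two (k : ℕ) :
    27 * (3 * (k : ℝ⟦X⟧) + 5) * (3 * (k : ℝ⟦X⟧) + 7) * antisym (k + 2) =
      (2 * (k : ℝ⟦X⟧) + 3) * (2 * (k : ℝ⟦X⟧) + 5) *
        (invariant * antisym k - 81 * antisym (k + 1)) := by
  have h : (27 * (3 * (k : ℝ⟦X⟧) + 5) * (3 * (k : ℝ⟦X⟧) + 7)) *
      C ((2 * (k : ℝ) + 3) * (2 * k + 5) / (27 * (3 * k + 5) * (3 * k + 7))) =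
      (2 * (k : ℝ⟦X⟧) + 3) * (2 * (k : ℝ⟦X⟧) + 5) := by
    have h2 : (2 * (k : ℝ⟦X⟧) + 3) * (2 * (k : ℝ⟦X⟧) + 5) =
        C ((2 * (k : ℝ) + 3) * (2 * k + 5)) := by
      simp [map_ofNat]
    rw [natCast_factor, h2, ← map_mul]
    congr 1
    field_simp
  rw [antisym, ← mul_assoc, h]

theorem derivative_mul_of_derivative_eq_zero {a : ℝ⟦X⟧} (ha : d⁄dX ℝ a = 0) (f : ℝ⟦X⟧) :
    d⁄dX ℝ (a * f) = a * d⁄dX ℝ f := by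
  simp [Derivation.leibniz, ha]

theorem derivative_antisym (k : ℕ) :
    (2 * (k : ℝ⟦X⟧) + 3) * (invariant * ((9 - 6 * X ^ 2 - 3 * X ^ 4) * d⁄dX ℝ (antisym k))) =
      (9 * X - X ^ 3) * (3 * ((k : ℝ⟦X⟧) + 1) * (2 * (k : ℝ⟦X⟧) + 3) * (invariant * antisym k) +
        (27 * (3 * (k : ℝ⟦X⟧) + 2) * (3 * (k : ℝ⟦X⟧) + 4) * antisym (k + 1) +
          81 * (2 * (k : ℝ⟦X⟧) + 1) * (2 * (k : ℝ⟦X⟧) + 3) * antisym k)) ∧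
    (9 - 6 * X ^ 2 - 3 * X ^ 4) * d⁄dX ℝ (antisym (k + 1)) =
      (9 * X - X ^ 3) *
        (3 * ((k : ℝ⟦X⟧) + 2) * antisym (k + 1) + (2 * (k : ℝ⟦X⟧) + 3) * antisym k) := by
  induction k with
  | zero =>
    have h := geomSq_mul
    have h3 : d⁄dX ℝ (3 : ℝ⟦X⟧) = 0 := (d⁄dX ℝ).map_natCast 3
    have h0 : d⁄dX ℝ (antisym 0) = C (1 / 3) * ((3 + 3 * X ^ 2) * geomSq +
        (3 * X + X ^ 3) * (2 * X * geomSq ^ 2)) := by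
      rw [antisym, mul_assoc]
      simp [Derivation.leibniz, Derivation.leibniz_pow, derivative_geomSq, h3]
      ring
    have h1 : d⁄dX ℝ (antisym 1) = C (1 / 3) * ((9 * X ^ 2 + 5 * X ^ 4) * geomSq ^ 2 +
        (3 * X ^ 3 + X ^ 5) * (4 * X * geomSq ^ 3)) := by
      rw [antisym, mul_assoc, mul_assoc]
      simp [Derivation.leibniz, Derivation.leibniz_pow, derivative_geomSq, h3]
      ring
    rw [zero_add, h0, h1, antisym, antisym, invariant]
    generalize geomSq = V at *
    generalize (X : ℝ⟦X⟧) = x at *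
    generalize (C (1 / 3) : ℝ⟦X⟧) = s at *
    push_cast
    constructor
    · grind
    · grind
  | succ k ih =>
    obtain ⟨hB, hA⟩ := ih
    have hT := derivative_invariant
    have hr := antisym_add_two k
    have hr' := congrArg (d⁄dX ℝ) hr
    have ha : d⁄dX ℝ (27 * (3 * (k : ℝ⟦X⟧) + 5) * (3 * (k : ℝ⟦X⟧) + 7)) = 0 := by
      exact_mod_cast (d⁄dX ℝ).map_natCast (27 * (3 * k + 5) * (3 * k + 7))
    have hb : d⁄dX ℝ ((2 * (k : ℝ⟦X⟧) + 3) * (2 * (k : ℝ⟦X⟧) + 5)) = 0 := by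
      exact_mod_cast (d⁄dX ℝ).map_natCast ((2 * k + 3) * (2 * k + 5))
    have hc : d⁄dX ℝ (81 : ℝ⟦X⟧) = 0 := (d⁄dX ℝ).map_natCast 81
    rw [derivative_mul_of_derivative_eq_zero ha, derivative_mul_of_derivative_eq_zero hb, map_sub,
      Derivation.leibniz, derivative_mul_of_derivative_eq_zero hc] at hr'
    simp only [smul_eq_mul] at hr'
    have h1 : 27 * (3 * (k : ℝ⟦X⟧) + 5) * (3 * (k : ℝ⟦X⟧) + 7) ≠ 0 := by
      rw [natCast_factor]
      exact (map_ne_zero_iff _ C_injective).mpr (by positivity)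
    constructor
    · push_cast
      linear_combination (2 * (k : ℝ⟦X⟧) + 5) * invariant * hA - (9 * X - X ^ 3) * hr
    · apply mul_left_cancel₀ h1
      push_cast
      linear_combination (9 - 6 * X ^ 2 - 3 * X ^ 4) * hr' + (2 * (k : ℝ⟦X⟧) + 5) * hB +
        (2 * (k : ℝ⟦X⟧) + 3) * (2 * (k : ℝ⟦X⟧) + 5) * (antisym k * hT - 81 * hA) -
        (9 * X - X ^ 3) * 3 * ((k : ℝ⟦X⟧) + 3) * hr

theorem antisym_order_step {f g : ℝ⟦X⟧} {c : ℝ⟦X⟧} {N : ℕ}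
    (h : (9 - 6 * X ^ 2 - 3 * X ^ 4) * d⁄dX ℝ f =
      (9 * X - X ^ 3) * (c * f + ((N : ℝ⟦X⟧) + 2) * (X ^ N * g))) (hf : X ∣ f) :
    ∃ q, f = X ^ (N + 2) * q ∧ constantCoeff q = constantCoeff g := by
  have hd : ∀ m ≤ N + 1, X ^ (m + 1) ∣ f := by
    intro m
    induction m with
    | zero => simpa using hf
    | succ m ih =>
      intro hm
      obtain ⟨q, rfl⟩ := ih (by omega)
      obtain ⟨d, rfl⟩ := Nat.exists_eq_add_of_le (show m ≤ N by omega)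
      have h0 : X ^ m * (9 * ((m : ℝ⟦X⟧) + 1) * q) = X ^ m * (X * (
          (9 - X ^ 2) * (c * X * q + ((m : ℝ⟦X⟧) + (d : ℝ⟦X⟧) + 2) * (X ^ d * g)) -
            (9 - 6 * X ^ 2 - 3 * X ^ 4) * d⁄dX ℝ q + (6 * X + 3 * X ^ 3) * ((m : ℝ⟦X⟧) + 1) * q)) := by
        simp [Derivation.leibniz, Derivation.leibniz_pow] at h
        linear_combination h
      have h1 := congrArg constantCoeff (mul_left_cancel₀ (pow_ne_zero m X_ne_zero) h0)
      have h2 : constantCoeff q = 0 := by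
        have : (m : ℝ) + 1 ≠ 0 := by positivity
        have h9 : constantCoeff (9 : ℝ⟦X⟧) = 9 := map_ofNat constantCoeff 9
        simpa [this, h9] using h1
      rw [pow_succ X (m + 1)]
      exact mul_dvd_mul_left _ (X_dvd_iff.mpr h2)
  obtain ⟨q, rfl⟩ := hd (N + 1) le_rfl
  refine ⟨q, rfl, ?_⟩
  have h0 : X ^ (N + 1) * ((9 - 6 * X ^ 2 - 3 * X ^ 4) * (((N : ℝ⟦X⟧) + 2) * q + X * d⁄dX ℝ q)) =
      X ^ (N + 1) * ((9 - X ^ 2) * (c * X ^ 2 * q + ((N : ℝ⟦X⟧) + 2) * g)) := by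
    simp [Derivation.leibniz, Derivation.leibniz_pow] at h
    linear_combination h
  have h1 := congrArg constantCoeff (mul_left_cancel₀ (pow_ne_zero _ X_ne_zero) h0)
  have h9 : constantCoeff (9 : ℝ⟦X⟧) = 9 := map_ofNat constantCoeff 9
  have h2 : constantCoeff (2 : ℝ⟦X⟧) = 2 := map_ofNat constantCoeff 2
  have : (N : ℝ) + 2 ≠ 0 := by positivity
  simpa [this, h9, h2] using h1

theorem antisym_order (k : ℕ) :
    ∃ q, antisym k = X ^ (2 * k + 1) * q ∧ constantCoeff q = 1 := by
  have hX : ∀ k, X ∣ antisym k := by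
    intro k
    induction k using Nat.twoStepInduction with
    | zero => exact ⟨C (1 / 3) * (3 + X ^ 2) * geomSq, by rw [antisym]; ring⟩
    | one => exact ⟨C (1 / 3) * (3 + X ^ 2) * geomSq * (X ^ 2 * geomSq), by rw [antisym]; ring⟩
    | more k h0 h1 =>
      rw [antisym]
      exact ((h0.mul_left _).sub (h1.mul_left _)).mul_left _
  induction k with
  | zero =>
    refine ⟨C (1 / 3) * (3 + X ^ 2) * geomSq, by rw [antisym]; ring, ?_⟩
    have h3 : constantCoeff (3 : ℝ⟦X⟧) = 3 := map_ofNat constantCoeff 3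
    have h := congrArg constantCoeff geomSq_mul
    simp at h
    simp [h3, h]
  | succ k ih =>
    obtain ⟨g, hg, hg1⟩ := ih
    have h := (derivative_antisym k).2
    rw [hg] at h
    obtain ⟨q, hq, hq1⟩ := antisym_order_step (g := g) (N := 2 * k + 1)
      (c := 3 * ((k : ℝ⟦X⟧) + 2)) (by rw [h]; push_cast; ring) (hX (k + 1))
    exact ⟨q, by rw [hq]; ring, hq1.trans hg1⟩

/-- `X (3 + X) / (1 - X)`. -/
noncomputable def twist : ℝ⟦X⟧ := X * (3 + X) * geom

theorem coe_rescaleAlgHom_apply (f : ℝ⟦X⟧) : rescaleAlgHom (-1) f = rescale (-1) f := by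
  rw [← coe_rescaleAlgHom, RingHom.coe_coe]

theorem rescale_C_eq (a : ℝ) : rescaleAlgHom (-1) (C a : ℝ⟦X⟧) = C a :=
  AlgHom.commutes (rescaleAlgHom (-1)) a

theorem rescale_twist : rescaleAlgHom (-1) twist = -(X * (3 - X) * geomAlt) := by
  have h3 : rescale (-1) (3 : ℝ⟦X⟧) = 3 := map_ofNat (rescale (-1)) 3
  rw [coe_rescaleAlgHom_apply, twist, map_mul, map_mul, map_add, h3, rescale_X, ← geomAlt]
  simp
  exact Or.inl (by ring)

theorem invariant_mul_twist_add_one : invariant * (twist + 1) = twist ^ 2 * (twist + 9) := by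
  have h1 := geom_mul
  have h2 := geomAlt_mul
  rw [invariant, geomSq, twist]
  generalize geom = I at *
  generalize geomAlt = K at *
  generalize (X : ℝ⟦X⟧) = x at *
  grind

theorem rescale_invariant : rescaleAlgHom (-1) invariant = invariant := by
  have h9 : rescale (-1) (9 : ℝ⟦X⟧) = 9 := map_ofNat (rescale (-1)) 9
  have h : rescale (-1) geomSq = geomSq := by
    have h1 := congrArg (rescale (-1 : ℝ)) geomSq_mul
    simp [rescale_X] at h1
    linear_combination geomSq * h1 - rescale (-1) geomSq * geomSq_mul
  rw [coe_rescaleAlgHom_apply]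
  simp [invariant, h, rescale_X, h9]
  exact Or.inl (by ring)

open Polynomial in
theorem exists_monic_aeval_sub_eq_antisym (n : ℕ) :
    ∃ p : ℝ[X], p.Monic ∧ p.natDegree = n + 1 ∧
      aeval twist p - rescaleAlgHom (-1) (aeval twist p) =
        PowerSeries.C (2 * detRatio (n + 1)) * antisym n := by
  induction n using Nat.twoStepInduction with
  | zero =>
    refine ⟨Polynomial.X, monic_X, by simp, ?_⟩
    have h1 := geom_mul
    have h2 := geomAlt_mul
    have h3 : (PowerSeries.C (1 / 3) : ℝ⟦X⟧) * 3 = 1 := by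
      rw [← map_ofNat PowerSeries.C 3, ← map_mul]; norm_num
    have h6 : (PowerSeries.C (2 * 3) : ℝ⟦X⟧) = 6 := by
      rw [← map_ofNat PowerSeries.C 6]; norm_num
    rw [aeval_X, rescale_twist, zero_add, detRatio_one, antisym, geomSq, twist, h6]
    generalize (PowerSeries.C (1 / 3) : ℝ⟦X⟧) = s at *
    generalize geom = I at *
    generalize geomAlt = K at *
    generalize (PowerSeries.X : ℝ⟦X⟧) = x at *
    grind
  | one =>
    refine ⟨Polynomial.X ^ 2, monic_X_pow 2, by simp, ?_⟩
    have h1 := geom_mul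
    have h2 := geomAlt_mul
    have h3 : (PowerSeries.C (1 / 3) : ℝ⟦X⟧) * 3 = 1 := by
      rw [← map_ofNat PowerSeries.C 3, ← map_mul]; norm_num
    have h6 : (PowerSeries.C (2 * 24) : ℝ⟦X⟧) = 48 := by
      rw [← map_ofNat PowerSeries.C 48]; norm_num
    rw [map_pow, map_pow, aeval_X, rescale_twist, one_add_one_eq_two, detRatio_two, antisym,
      geomSq, twist, h6]
    generalize (PowerSeries.C (1 / 3) : ℝ⟦X⟧) = s at *
    generalize geom = I at *
    generalize geomAlt = K at *
    generalize (PowerSeries.X : ℝ⟦X⟧) = x at *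
    grind
  | more n hp hq =>
    obtain ⟨p, hp, hpd, hpe⟩ := hp
    obtain ⟨q, hq, hqd, hqe⟩ := hq
    have hr := detRatio_add_two (Nat.succ_pos n)
    have hr2 := (detRatio_pos (Nat.succ_pos (n + 1))).ne'
    have hdiv := modByMonic_add_div p (Polynomial.X - Polynomial.C (-1 : ℝ))
    rw [modByMonic_X_sub_C_eq_C_eval] at hdiv
    obtain ⟨s, hs⟩ : ∃ s, s = p /ₘ (Polynomial.X - Polynomial.C (-1 : ℝ)) := ⟨_, rfl⟩
    have hsm : s.Monic := by
      rw [hs, Monic, leadingCoeff_divByMonic_of_monic (monic_X_sub_C _), hp.leadingCoeff]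
      rw [degree_X_sub_C, degree_eq_natDegree hp.ne_zero, hpd]
      exact_mod_cast Nat.le_add_left 1 n
    have hsd : s.natDegree = n := by
      rw [hs, natDegree_divByMonic _ (monic_X_sub_C _), natDegree_X_sub_C, hpd, Nat.add_sub_cancel]
    rw [← hs] at hdiv
    have hm : (Polynomial.X ^ 2 * (Polynomial.X + Polynomial.C 9) * s : ℝ[X]).Monic :=
      ((monic_X_pow 2).mul (monic_X_add_C 9)).mul hsm
    have hmd : (Polynomial.X ^ 2 * (Polynomial.X + Polynomial.C 9) * s : ℝ[X]).natDegree =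
        n + 3 := by
      rw [((monic_X_pow 2).mul (monic_X_add_C 9)).natDegree_mul hsm,
        (monic_X_pow 2).natDegree_mul (monic_X_add_C 9), natDegree_X_pow, natDegree_X_add_C, hsd]
      ring
    have hlt : (Polynomial.C (81 * detRatio (n + 1) / detRatio (n + 2)) * q).natDegree < n + 3 :=
      (natDegree_C_mul_le _ _).trans_lt (by omega)
    refine ⟨Polynomial.X ^ 2 * (Polynomial.X + Polynomial.C 9) * s -
      Polynomial.C (81 * detRatio (n + 1) / detRatio (n + 2)) * q, hm.sub_of_left ?_, ?_, ?_⟩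
    · exact degree_lt_degree (by rwa [hmd])
    · rw [natDegree_sub_eq_left_of_natDegree_lt (by rwa [hmd]), hmd]
    · have h9 : aeval twist (Polynomial.C 9 : ℝ[X]) = 9 := by simp [map_ofNat]
      have hp1 : aeval twist (Polynomial.X ^ 2 * (Polynomial.X + Polynomial.C 9) * s) =
          invariant * (aeval twist p - PowerSeries.C (p.eval (-1))) := by
        rw [← hdiv]
        simp [h9]
        linear_combination -(aeval twist s) * invariant_mul_twist_add_one
      have hp2 := congrArg (rescaleAlgHom (-1)) hp1
      rw [map_mul (rescaleAlgHom (-1)) invariant, map_sub, rescale_invariant, rescale_C_eq] at hp2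
      have hl : aeval twist (Polynomial.C (81 * detRatio (n + 1) / detRatio (n + 2)) * q) =
          PowerSeries.C (81 * detRatio (n + 1) / detRatio (n + 2)) * aeval twist q := by
        simp
      have hl2 := congrArg (rescaleAlgHom (-1)) hl
      rw [map_mul (rescaleAlgHom (-1)) (PowerSeries.C _), rescale_C_eq] at hl2
      have c1 : (PowerSeries.C (81 * detRatio (n + 1) / detRatio (n + 2)) *
          PowerSeries.C (2 * detRatio (n + 1 + 1)) : ℝ⟦X⟧) =
            81 * PowerSeries.C (2 * detRatio (n + 1)) := by
        rw [← map_ofNat PowerSeries.C 81, ← map_mul, ← map_mul]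
        congr 1
        field_simp
      have c2 : (PowerSeries.C (2 * detRatio (n + 2 + 1)) * PowerSeries.C
          ((2 * (n : ℝ) + 3) * (2 * n + 5) / (27 * (3 * n + 5) * (3 * n + 7))) : ℝ⟦X⟧) =
            PowerSeries.C (2 * detRatio (n + 1)) := by
        rw [← map_mul]
        congr 1
        push_cast [add_assoc] at hr ⊢
        field_simp
        linear_combination hr
      rw [antisym, ← mul_assoc, c2, map_sub, map_sub, hp2, hp1, hl2, hl]
      linear_combination invariant * hpe -
        PowerSeries.C (81 * detRatio (n + 1) / detRatio (n + 2)) * hqe - antisym (n + 1) * c1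

open Polynomial in
theorem exists_monic_aeval_twist (n : ℕ) :
    ∃ p : ℝ[X], p.Monic ∧ p.natDegree = n + 1 ∧
      aeval twist p = (1 - PowerSeries.X) ^ (n + 1) + (4 * geom) ^ (n + 1) := by
  have hY : twist + 5 = (1 - PowerSeries.X) + 4 * geom := by
    rw [twist]
    linear_combination -(4 + PowerSeries.X) * geom_mul
  have h5 : aeval twist (Polynomial.C 5 : ℝ[X]) = 5 := by simp [map_ofNat]
  induction n using Nat.twoStepInduction with
  | zero =>
    exact ⟨Polynomial.X + Polynomial.C 5, monic_X_add_C 5, by simp, by simp [h5, hY]⟩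
  | one =>
    have h8 : aeval twist (Polynomial.C 8 : ℝ[X]) = 8 := by simp [map_ofNat]
    have hm : ((Polynomial.X + Polynomial.C 5) ^ 2 : ℝ[X]).Monic := (monic_X_add_C 5).pow 2
    have hmd : ((Polynomial.X + Polynomial.C 5) ^ 2 : ℝ[X]).natDegree = 2 := by
      simp
    refine ⟨(Polynomial.X + Polynomial.C 5) ^ 2 - Polynomial.C 8, hm.sub_of_left ?_, ?_, ?_⟩
    · exact degree_lt_degree (by rw [hmd]; simp)
    · rw [natDegree_sub_C, hmd]
    · rw [map_sub, map_pow, map_add, aeval_X, h5, h8, hY]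
      linear_combination 8 * geom_mul
  | more n hp hq =>
    obtain ⟨p, hp, hpd, hpe⟩ := hp
    obtain ⟨q, hq, hqd, hqe⟩ := hq
    have hm : ((Polynomial.X + Polynomial.C 5) * q : ℝ[X]).Monic := (monic_X_add_C 5).mul hq
    have hmd : ((Polynomial.X + Polynomial.C 5) * q : ℝ[X]).natDegree = n + 3 := by
      rw [(monic_X_add_C 5).natDegree_mul hq, natDegree_X_add_C, hqd]
      ring
    have hlt : (Polynomial.C 4 * p).natDegree < n + 3 :=
      (natDegree_C_mul_le _ _).trans_lt (by omega)
    have h4 : aeval twist (Polynomial.C 4 : ℝ[X]) = 4 := by simp [map_ofNat]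
    refine ⟨(Polynomial.X + Polynomial.C 5) * q - Polynomial.C 4 * p, hm.sub_of_left ?_, ?_, ?_⟩
    · exact degree_lt_degree (by rwa [hmd])
    · rw [natDegree_sub_eq_left_of_natDegree_lt (by rwa [hmd]), hmd]
    · rw [map_sub, map_mul, map_mul, map_add, aeval_X, h5, h4, hY, hpe, hqe]
      linear_combination 4 * ((1 - PowerSeries.X) ^ (n + 1) + (4 * geom) ^ (n + 1)) * geom_mul

theorem coeff_sub_rescale (f : ℝ⟦X⟧) (i : ℕ) :
    coeff (2 * i + 1) (f - rescaleAlgHom (-1) f) = 2 * coeff (2 * i + 1) f := by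
  rw [map_sub, coe_rescaleAlgHom_apply, coeff_rescale, Odd.neg_one_pow ⟨i, rfl⟩]
  ring

theorem coeff_one_sub_X_pow (m i : ℕ) :
    coeff (2 * i + 1) ((1 - X : ℝ⟦X⟧) ^ m) = -(m.choose (2 * i + 1) : ℝ) := by
  have h : (1 - X : ℝ⟦X⟧) ^ m = rescale (-1) (((1 + Polynomial.X) ^ m : Polynomial ℝ) : ℝ⟦X⟧) := by
    simp [rescale_X, sub_eq_add_neg]
  rw [h, coeff_rescale, Polynomial.coeff_coe, Polynomial.coeff_one_add_X_pow,
    Odd.neg_one_pow ⟨i, rfl⟩]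
  ring

theorem coeff_geom_pow (m i : ℕ) :
    coeff i (geom ^ (m + 1)) = ((m + i).choose i : ℝ) := by
  rw [geom, mk_one_pow_eq_mk_choose_add, coeff_mk, Nat.choose_symm_add]

theorem binom_eq_coeff (i j : ℕ) :
    (4 : ℝ) ^ (j + 1) * binom (2 * (i : ℤ) + (j : ℤ) + 1) (2 * i + 1)
          + binom (2 * (i : ℤ) - (j : ℤ) - 1) (2 * i + 1) =
      coeff (2 * i + 1) ((1 - X : ℝ⟦X⟧) ^ (j + 1) + (4 * geom) ^ (j + 1)) := by
  have h1 : 2 * (i : ℤ) + (j : ℤ) + 1 = ((j + (2 * i + 1) : ℕ) : ℤ) := by push_cast; ring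
  have h2 : 2 * (i : ℤ) - (j : ℤ) - 1 = 2 * (i : ℤ) - ((j + 1 : ℕ) : ℤ) := by push_cast; ring
  have h4 : (4 * geom) ^ (j + 1) = C ((4 : ℝ) ^ (j + 1)) * geom ^ (j + 1) := by
    rw [mul_pow, map_pow, map_ofNat]
  rw [h1, h2, binom_natCast, binom_reflect, map_add, coeff_one_sub_X_pow, h4, coeff_C_mul,
    coeff_geom_pow]
  ring

end TwistedPair

open PowerSeries TwistedPair in
theorem stmt_10 (n : ℕ) (hn : 0 < n) :
    (Matrix.of fun i j : Fin n =>
        (4 : ℝ) ^ ((j : ℕ) + 1) * binom (2 * ((i : ℕ) : ℤ) + ((j : ℕ) : ℤ) + 1) (2 * (i : ℕ) + 1)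
          + binom (2 * ((i : ℕ) : ℤ) - ((j : ℕ) : ℤ) - 1) (2 * (i : ℕ) + 1)).det =
      3 ^ (n * (n + 1) / 2) * ∏ i ∈ Finset.Icc 1 n,
          Real.Gamma (3 * (i : ℝ) - 1) * Real.Gamma (((i : ℝ) + 1) / 2)
            / (Real.Gamma (2 * (i : ℝ)) * Real.Gamma ((3 * (i : ℝ) - 1) / 2)) := by
  choose p hp hpd hpe using exists_monic_aeval_sub_eq_antisym
  choose q hq hqd hqe using exists_monic_aeval_twist
  let L : Fin n → Polynomial ℝ →ₗ[ℝ] ℝ := fun i =>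
    (coeff (2 * (i : ℕ) + 1)).comp (Polynomial.aeval twist).toLinearMap
  have hL : ∀ i, L i 1 = 0 := by
    intro i
    simp [L, coeff_one]
  have hLp : ∀ i (j : ℕ), L i (p j) = detRatio (j + 1) * coeff (2 * (i : ℕ) + 1) (antisym j) := by
    intro i j
    have h := coeff_sub_rescale (Polynomial.aeval twist (p j)) i
    rw [hpe, coeff_C_mul] at h
    change coeff _ (Polynomial.aeval twist (p j)) = _
    linarith
  simp only [binom_eq_coeff, ← hqe]
  refine (det_functional_eq_det_X_pow L hL (fun j => q j) (fun j => hq j) fun j => hqd j).trans ?_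
  rw [← det_functional_eq_det_X_pow L hL (fun j => p j) (fun j => hp j) fun j => hpd j,
    prod_detRatio, Matrix.det_of_isLowerTriangular]
  · refine Finset.prod_congr rfl fun j _ => ?_
    obtain ⟨g, hg, hg1⟩ := antisym_order j
    rw [Matrix.of_apply, hLp, hg, coeff_X_pow_mul', if_pos le_rfl, Nat.sub_self,
      coeff_zero_eq_constantCoeff_apply, hg1, mul_one]
  · intro i j hij
    obtain ⟨g, hg, -⟩ := antisym_order j
    have : (i : ℕ) < j := hij
    rw [Matrix.of_apply, hLp, hg, coeff_X_pow_mul', if_neg (by omega), mul_zero]
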